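/- arXiv:2408.07794 — 5 statements merged into one kernel-verified Lean document; each statement's English description precedes it below -/
import Mathlib

section
/- Let n ≥ 2, let x ∈ ℂ^{n-1}, and let H be the Hermitian n×n matrix in block form H = [[0, x*], [x, 0]]. Then the energy uncertainty of H at the first standard basis vector e₀ satisfies ΔE_{e₀}(H)² = ‖x‖², and for every unit vector φ ∈ ℂⁿ one has ΔE_φ(H)² ≤ ‖x‖². In particular, e₀ maximizes the energy uncertainty of H among all unit vectors. -/
open Matrix

/-- The squared energy uncertainty of a Hermitian matrix `M` at a unit vector `ψ`:
`ΔE_ψ(M)² = ⟨ψ, M²ψ⟩ - ⟨ψ, Mψ⟩²`. -/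
noncomputable def eVar {ι : Type*} [Fintype ι] (M : Matrix ι ι ℂ) (ψ : ι → ℂ) : ℝ :=
  (star ψ ⬝ᵥ (M * M) *ᵥ ψ).re - ((star ψ ⬝ᵥ M *ᵥ ψ).re) ^ 2

theorem star_dotProduct_self_re {ι : Type*} [Fintype ι] (v : ι → ℂ) :
    (star v ⬝ᵥ v).re = ∑ i, ‖v i‖ ^ 2 := by
  simp [dotProduct, ← Complex.normSq_eq_norm_sq, Complex.normSq_apply]

theorem eVar_eq_of_isHermitian {ι : Type*} [Fintype ι] {M : Matrix ι ι ℂ}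
    (hM : M.IsHermitian) (ψ : ι → ℂ) :
    eVar M ψ = ∑ i, ‖(M *ᵥ ψ) i‖ ^ 2 - ((star ψ ⬝ᵥ M *ᵥ ψ).re) ^ 2 := by
  rw [eVar, ← star_dotProduct_self_re, star_mulVec, hM.eq, ← mulVec_mulVec,
    dotProduct_mulVec (star ψ) M (M *ᵥ ψ)]

theorem norm_sq_dotProduct_le {ι : Type*} [Fintype ι] (v w : ι → ℂ) :
    ‖v ⬝ᵥ w‖ ^ 2 ≤ (∑ i, ‖v i‖ ^ 2) * ∑ i, ‖w i‖ ^ 2 := by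
  calc ‖v ⬝ᵥ w‖ ^ 2 ≤ (∑ i, ‖v i‖ * ‖w i‖) ^ 2 := by
        gcongr
        simpa only [dotProduct, norm_mul] using norm_sum_le Finset.univ fun i => v i * w i
    _ ≤ _ := Finset.sum_mul_sq_le_sq_mul_sq _ _ _

/-- For the Hermitian matrix `H = [[0, x*],[x, 0]]`, the squared energy
uncertainty at the first standard basis vector `e₀` equals `‖x‖²`, and for every unit
vector `φ` one has `ΔE_φ(H)² ≤ ‖x‖²`. -/
theorem stmt_2 (m : ℕ) (hm : 1 ≤ m) (x : Fin m → ℂ) :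
    let H : Matrix (Fin 1 ⊕ Fin m) (Fin 1 ⊕ Fin m) ℂ :=
      fromBlocks 0 (of fun _ j => (starRingEnd ℂ) (x j)) (of fun i _ => x i) 0
    let e₀ : Fin 1 ⊕ Fin m → ℂ := Sum.elim (fun _ => 1) (fun _ => 0)
    (eVar H e₀ = ∑ i, ‖x i‖ ^ 2) ∧
    ∀ φ : Fin 1 ⊕ Fin m → ℂ, (∑ j, ‖φ j‖ ^ 2 = 1) →
      eVar H φ ≤ ∑ i, ‖x i‖ ^ 2 := by
  intro H e₀
  have hH : H.IsHermitian := by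
    refine IsHermitian.fromBlocks isHermitian_zero ?_ isHermitian_zero
    ext i j
    simp
  have hl (φ : Fin 1 ⊕ Fin m → ℂ) (i : Fin 1) :
      (H *ᵥ φ) (Sum.inl i) = star x ⬝ᵥ fun j => φ (Sum.inr j) := by
    simp [H, mulVec, dotProduct]
  have hr (φ : Fin 1 ⊕ Fin m → ℂ) (i : Fin m) :
      (H *ᵥ φ) (Sum.inr i) = x i * φ (Sum.inl 0) := by
    simp [H, mulVec, dotProduct]
  refine ⟨?_, fun φ hφ => ?_⟩
  · rw [eVar_eq_of_isHermitian hH]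
    simp [dotProduct, hl, hr, e₀]
  · rw [eVar_eq_of_isHermitian hH]
    have hcs := norm_sq_dotProduct_le (star x) fun j => φ (Sum.inr j)
    simp only [Fintype.sum_sum_type, Fin.sum_univ_one] at hφ
    simp only [Pi.star_apply, norm_star] at hcs
    calc _ ≤ ∑ i, ‖(H *ᵥ φ) i‖ ^ 2 := sub_le_self _ (sq_nonneg _)
      _ = ‖star x ⬝ᵥ fun j => φ (Sum.inr j)‖ ^ 2
          + (∑ i, ‖x i‖ ^ 2) * ‖φ (Sum.inl 0)‖ ^ 2 := by
        simp [hl, hr, mul_pow, Finset.sum_mul]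
      _ ≤ (∑ i, ‖x i‖ ^ 2) * (‖φ (Sum.inl 0)‖ ^ 2 + ∑ j, ‖φ (Sum.inr j)‖ ^ 2) := by
        linarith
      _ = ∑ i, ‖x i‖ ^ 2 := by rw [hφ, mul_one]
end

section
/- Let n ≥ 2 and let H be the Hermitian n×n matrix in block form H = [[α, x*], [x, A]], where α ∈ ℝ, x ∈ ℂ^{n-1} with x ≠ 0, and A is an (n-1)×(n-1) Hermitian matrix. Suppose x is not an eigenvector of A (i.e., Ax is not a scalar multiple of x). Then the unit vector φ = (0, x/‖x‖) ∈ ℂⁿ satisfies ΔE_φ(H)² = ‖x‖² + ΔE_{x/‖x‖}(A)², and in particular ΔE_φ(H)² > ‖x‖². -/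
open Matrix

open scoped ComplexOrder in
lemma re_star_dotProduct_self_pos {ι : Type*} [Fintype ι] {v : ι → ℂ} (hv : v ≠ 0) :
    0 < (star v ⬝ᵥ v).re :=
  (Complex.pos_iff.mp (dotProduct_star_self_pos_iff.mpr hv)).1

/-- A Hermitian matrix has positive uncertainty at a unit vector which is not an eigenvector. -/
lemma eVar_pos_of_forall_ne_smul {ι : Type*} [Fintype ι] {M : Matrix ι ι ℂ}
    (hM : M.IsHermitian) {u : ι → ℂ} (hu : star u ⬝ᵥ u = 1)
    (h : ∀ c : ℂ, M *ᵥ u ≠ c • u) : 0 < eVar M u := by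
  set c : ℝ := (star u ⬝ᵥ M *ᵥ u).re with hc
  have hadj (w : ι → ℂ) : star (M *ᵥ u) ⬝ᵥ w = star u ⬝ᵥ M *ᵥ w := by
    rw [star_mulVec, hM.eq, dotProduct_mulVec]
  have hv : M *ᵥ u - (c : ℂ) • u ≠ 0 := sub_ne_zero.mpr (h c)
  have hpos := re_star_dotProduct_self_pos hv
  have hexp : star (M *ᵥ u - (c : ℂ) • u) ⬝ᵥ (M *ᵥ u - (c : ℂ) • u) =
      star u ⬝ᵥ (M * M) *ᵥ u - 2 * c * (star u ⬝ᵥ M *ᵥ u) + c ^ 2 := by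
    simp only [star_sub, star_smul, sub_dotProduct, dotProduct_sub, smul_dotProduct,
      dotProduct_smul, hadj, hu, mulVec_mulVec, smul_eq_mul, Complex.star_def, Complex.conj_ofReal]
    ring
  rw [hexp] at hpos
  have hre : (star u ⬝ᵥ (M * M) *ᵥ u - 2 * c * (star u ⬝ᵥ M *ᵥ u) + c ^ 2 : ℂ).re =
      (star u ⬝ᵥ (M * M) *ᵥ u).re - 2 * c * c + c ^ 2 := by
    rw [hc]
    simp [pow_two]
  rw [hre] at hpos
  unfold eVar
  linarith

/-- For the Hermitian matrix `H = [[α, x*],[x, A]]` with `x ≠ 0` and `x` not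
an eigenvector of `A`, the unit vector `φ = (0, x/‖x‖)` satisfies
`ΔE_φ(H)² = ‖x‖² + ΔE_{x/‖x‖}(A)² > ‖x‖²`. -/
theorem stmt_4 (m : ℕ) (hm : 1 ≤ m) (α : ℝ) (x : Fin m → ℂ) (hx : x ≠ 0)
    (A : Matrix (Fin m) (Fin m) ℂ) (hA : A.IsHermitian)
    (heig : ∀ c : ℂ, A *ᵥ x ≠ c • x) :
    let H : Matrix (Fin 1 ⊕ Fin m) (Fin 1 ⊕ Fin m) ℂ :=
      fromBlocks (of fun _ _ => (α : ℂ))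
        (of fun _ j => (starRingEnd ℂ) (x j)) (of fun i _ => x i) A
    let u : Fin m → ℂ := fun i => x i / (Real.sqrt (∑ i, ‖x i‖ ^ 2) : ℂ)
    let φ : Fin 1 ⊕ Fin m → ℂ := Sum.elim (fun _ => 0) u
    (eVar H φ = (∑ i, ‖x i‖ ^ 2) + eVar A u) ∧ eVar H φ > ∑ i, ‖x i‖ ^ 2 := by
  intro H u φ
  set N : ℝ := ∑ i, ‖x i‖ ^ 2 with hN
  have hself : star x ⬝ᵥ x = (N : ℂ) := by
    simp [dotProduct, hN, Complex.conj_mul']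
  have hNpos : 0 < N := by
    have h := re_star_dotProduct_self_pos hx
    rwa [hself, Complex.ofReal_re] at h
  have hsq : ((Real.sqrt N : ℝ) : ℂ) * (Real.sqrt N : ℝ) = N := by
    rw [← Complex.ofReal_mul, Real.mul_self_sqrt hNpos.le]
  have hs0 : ((Real.sqrt N : ℝ) : ℂ) ≠ 0 := by
    exact_mod_cast (Real.sqrt_pos.mpr hNpos).ne'
  have hxu : x = ((Real.sqrt N : ℝ) : ℂ) • u := by
    ext i
    simp only [u, Pi.smul_apply, smul_eq_mul]
    exact (mul_div_cancel₀ _ hs0).symm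
  have hu : star u ⬝ᵥ u = 1 := by
    have h := hself
    rw [hxu] at h
    simp only [star_smul, smul_dotProduct, dotProduct_smul, smul_eq_mul, Complex.star_def,
      Complex.conj_ofReal] at h
    rw [← mul_assoc, hsq] at h
    exact mul_left_cancel₀ (Complex.ofReal_ne_zero.mpr hNpos.ne') (h.trans (mul_one _).symm)
  have hux : star u ⬝ᵥ x = (Real.sqrt N : ℝ) := by
    rw [hxu, dotProduct_smul, hu, smul_eq_mul, mul_one]
  have hxu' : star x ⬝ᵥ u = (Real.sqrt N : ℝ) := by
    rw [hxu, star_smul, smul_dotProduct, hu]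
    simp
  have hHφ : H *ᵥ φ = Sum.elim (fun _ => ((Real.sqrt N : ℝ) : ℂ)) (A *ᵥ u) := by
    rw [← hxu']
    ext (i | i) <;> simp [H, φ, mulVec, dotProduct]
  have hdot (a : Fin 1 → ℂ) (b : Fin m → ℂ) : star φ ⬝ᵥ Sum.elim a b = star u ⬝ᵥ b := by
    simp [φ, dotProduct]
  have hHHφ : (H * H) *ᵥ φ = Sum.elim (fun _ => α * ((Real.sqrt N : ℝ) : ℂ) + star x ⬝ᵥ A *ᵥ u)
      (((Real.sqrt N : ℝ) : ℂ) • x + A *ᵥ A *ᵥ u) := by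
    rw [← mulVec_mulVec, hHφ]
    ext (i | i) <;> simp [H, mulVec, dotProduct, mul_comm, -mulVec_mulVec]
  have heq : eVar H φ = N + eVar A u := by
    simp only [eVar, hHφ, hHHφ, hdot, mulVec_mulVec, dotProduct_add, dotProduct_smul, hux, smul_eq_mul, hsq,
      Complex.add_re, Complex.ofReal_re]
    ring
  have hpos : 0 < eVar A u := by
    refine eVar_pos_of_forall_ne_smul hA hu fun c hc => heig c ?_
    rw [hxu, mulVec_smul, hc, smul_comm]
  exact ⟨heq, by linarith⟩
end

section
/- Let n ≥ 2 and let H be the Hermitian n×n matrix in block form H = [[α, x*], [x, A]], where α ∈ ℝ, x ∈ ℂ^{n-1} with x ≠ 0, and A is an (n-1)×(n-1) Hermitian matrix satisfying Ax = ζx for some real number ζ with ζ ≠ α. Then both λ₊ = ((α+ζ) + √((α-ζ)² + 4‖x‖²))/2 and λ₋ = ((α+ζ) - √((α-ζ)² + 4‖x‖²))/2 are eigenvalues of H, and (λ₊ - λ₋)/2 > ‖x‖. -/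
open Matrix

/-- If `A x = ζ x` and `(l - α)(l - ζ) = ‖x‖²`, then `(l - ζ, x)` is an eigenvector of
`[[α, x*], [x, A]]` with eigenvalue `l`. -/
theorem exists_eigenvector_bordered {ι : Type*} [Fintype ι] {α ζ l : ℝ} {x : ι → ℂ} (hx : x ≠ 0)
    {A : Matrix ι ι ℂ} (heig : A *ᵥ x = (ζ : ℂ) • x)
    (hl : (l - α) * (l - ζ) = ∑ i, ‖x i‖ ^ 2) :
    ∃ v : Fin 1 ⊕ ι → ℂ, v ≠ 0 ∧
      fromBlocks (of fun _ _ => (α : ℂ))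
        (of fun _ j => (starRingEnd ℂ) (x j)) (of fun i _ => x i) A *ᵥ v = (l : ℂ) • v := by
  refine ⟨Sum.elim (fun _ => (l : ℂ) - ζ) x, fun h => hx ?_, ?_⟩
  · ext i
    exact congrFun h (Sum.inr i)
  · have hsum : ∑ i, (starRingEnd ℂ) (x i) * x i = ((l : ℂ) - α) * (l - ζ) := by
      simp only [Complex.conj_mul']
      exact_mod_cast hl.symm
    rw [fromBlocks_mulVec]
    ext (i | i)
    · simp only [Sum.elim_comp_inl, Sum.elim_comp_inr, Sum.elim_inl, Pi.add_apply, Pi.smul_apply,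
        smul_eq_mul, mulVec, dotProduct, of_apply, hsum, Finset.univ_unique, Finset.sum_singleton]
      ring
    · simp only [Sum.elim_comp_inl, Sum.elim_comp_inr, heig, Sum.elim_inr, Pi.add_apply,
        Pi.smul_apply, smul_eq_mul, mulVec, dotProduct, of_apply, Finset.univ_unique,
        Finset.sum_singleton]
      ring

/-- For the Hermitian matrix `H = [[α, x*],[x, A]]` with `x ≠ 0` satisfying
`Ax = ζx` where `ζ ≠ α` is real, both `λ± = ((α+ζ) ± √((α-ζ)² + 4‖x‖²))/2` are
eigenvalues of `H`, and `(λ₊ - λ₋)/2 > ‖x‖`. -/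
theorem stmt_5 (m : ℕ) (hm : 1 ≤ m) (α ζ : ℝ) (hζ : ζ ≠ α) (x : Fin m → ℂ) (hx : x ≠ 0)
    (A : Matrix (Fin m) (Fin m) ℂ) (hA : A.IsHermitian)
    (heig : A *ᵥ x = (ζ : ℂ) • x) :
    let H : Matrix (Fin 1 ⊕ Fin m) (Fin 1 ⊕ Fin m) ℂ :=
      fromBlocks (of fun _ _ => (α : ℂ))
        (of fun _ j => (starRingEnd ℂ) (x j)) (of fun i _ => x i) A
    let nx : ℝ := Real.sqrt (∑ i, ‖x i‖ ^ 2)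
    let lp : ℝ := ((α + ζ) + Real.sqrt ((α - ζ) ^ 2 + 4 * nx ^ 2)) / 2
    let lm : ℝ := ((α + ζ) - Real.sqrt ((α - ζ) ^ 2 + 4 * nx ^ 2)) / 2
    (∃ v : Fin 1 ⊕ Fin m → ℂ, v ≠ 0 ∧ H *ᵥ v = (lp : ℂ) • v) ∧
    (∃ v : Fin 1 ⊕ Fin m → ℂ, v ≠ 0 ∧ H *ᵥ v = (lm : ℂ) • v) ∧
    (lp - lm) / 2 > nx := by
  intro H nx lp lm
  have hnx : nx ^ 2 = ∑ i, ‖x i‖ ^ 2 := Real.sq_sqrt (by positivity)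
  have hs : Real.sqrt ((α - ζ) ^ 2 + 4 * nx ^ 2) ^ 2 = (α - ζ) ^ 2 + 4 * nx ^ 2 :=
    Real.sq_sqrt (by positivity)
  refine ⟨exists_eigenvector_bordered hx heig ?_, exists_eigenvector_bordered hx heig ?_, ?_⟩
  · rw [← hnx]
    linear_combination hs / 4
  · rw [← hnx]
    linear_combination hs / 4
  · have hlt : 2 * nx < Real.sqrt ((α - ζ) ^ 2 + 4 * nx ^ 2) := by
      apply Real.lt_sqrt_of_sq_lt
      have := sq_pos_of_ne_zero (sub_ne_zero.mpr hζ.symm)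
      linarith
    simp only [lp, lm]
    linarith
end

section
/- Let n ≥ 2 and let H be the Hermitian n×n matrix in block form H = [[α, x*], [x, A]], where α ∈ ℝ, x ∈ ℂ^{n-1}, and A is an (n-1)×(n-1) Hermitian matrix. If Ax ≠ αx, then there exists a density matrix ρ on ℂⁿ such that Tr(H²ρ) - (Tr(Hρ))² > ‖x‖². In other words, the maximal energy uncertainty of H strictly exceeds ‖x‖. -/
open Matrix
open scoped ComplexOrder

/-- The squared energy uncertainty of a Hermitian matrix `H` in the state given by a
density matrix `ρ`: `Tr(H²ρ) - (Tr(Hρ))²`. -/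
noncomputable def dVar {ι : Type*} [Fintype ι] [DecidableEq ι]
    (H ρ : Matrix ι ι ℂ) : ℝ :=
  ((H * H * ρ).trace).re - (((H * ρ).trace).re) ^ 2

/-- The squared uncertainty does not change when a real multiple of the identity is added. -/
lemma dVar_add_smul_one {ι : Type*} [Fintype ι] [DecidableEq ι]
    (K ρ : Matrix ι ι ℂ) (a : ℝ) (hρ : ρ.trace = 1) :
    dVar (K + (a : ℂ) • (1 : Matrix ι ι ℂ)) ρ = dVar K ρ := by
  simp only [dVar, add_mul, mul_add, smul_mul_assoc, mul_smul_comm, one_mul, mul_one,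
    trace_add, trace_smul, hρ, smul_eq_mul, Complex.add_re, Complex.re_ofReal_mul,
    Complex.ofReal_re]
  ring

lemma trace_mul_vecMulVec {ι : Type*} [Fintype ι] (M : Matrix ι ι ℂ) (u v : ι → ℂ) :
    (M * vecMulVec u v).trace = v ⬝ᵥ M *ᵥ u := by
  rw [mul_vecMulVec, trace_vecMulVec, dotProduct_comm]

lemma star_add_smul_dotProduct_mulVec {ι : Type*} [Fintype ι] (M : Matrix ι ι ℂ)
    (u w : ι → ℂ) (t : ℝ) :
    (star (u + (t : ℂ) • w) ⬝ᵥ M *ᵥ (u + (t : ℂ) • w)).re =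
      (star u ⬝ᵥ M *ᵥ u).re + t * (star u ⬝ᵥ M *ᵥ w + star w ⬝ᵥ M *ᵥ u).re
        + t ^ 2 * (star w ⬝ᵥ M *ᵥ w).re := by
  simp only [star_add, star_smul, mulVec_add, mulVec_smul, add_dotProduct, dotProduct_add,
    smul_dotProduct, dotProduct_smul, smul_eq_mul, RCLike.star_def, Complex.conj_ofReal,
    Complex.add_re, Complex.re_ofReal_mul]
  ring

/-- If `q - r²/N` has positive derivative at `0`, it exceeds its value at `0` somewhere. -/
lemma exists_lt_quotient_sub_sq {p : ℝ} (hp : 0 < p) (c g r s k : ℝ) (hk : 0 ≤ k) :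
    ∃ t : ℝ, c < (1 + t ^ 2 * k)⁻¹ * (c + t * p + t ^ 2 * g)
      - ((1 + t ^ 2 * k)⁻¹ * (t * r + t ^ 2 * s)) ^ 2 := by
  have hcont : Continuous fun t : ℝ => (p + t * g) * (1 + t ^ 2 * k)
      - t * (r + t * s) ^ 2 - c * t * k * (1 + t ^ 2 * k) := by fun_prop
  have hev : ∀ᶠ t in nhds (0 : ℝ), 0 < (p + t * g) * (1 + t ^ 2 * k)
      - t * (r + t * s) ^ 2 - c * t * k * (1 + t ^ 2 * k) :=
    hcont.continuousAt.eventually_const_lt (by simpa using hp)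
  obtain ⟨t, ht, ht0⟩ :=
    ((hev.filter_mono nhdsWithin_le_nhds).and
      (self_mem_nhdsWithin : Set.Ioi (0 : ℝ) ∈ nhdsWithin 0 (Set.Ioi 0))).exists
  refine ⟨t, ?_⟩
  have ht0 : 0 < t := ht0
  have hN : 0 < 1 + t ^ 2 * k := by positivity
  rw [← sub_pos]
  have key : (1 + t ^ 2 * k)⁻¹ * (c + t * p + t ^ 2 * g)
      - ((1 + t ^ 2 * k)⁻¹ * (t * r + t ^ 2 * s)) ^ 2 - c =
      t * ((p + t * g) * (1 + t ^ 2 * k)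
        - t * (r + t * s) ^ 2 - c * t * k * (1 + t ^ 2 * k)) / (1 + t ^ 2 * k) ^ 2 := by
    field_simp
    ring
  rw [key]
  positivity

/-- A pure state whose squared uncertainty increases to first order in the direction `w`
is not maximal. -/
lemma exists_dVar_gt {ι : Type*} [Fintype ι] [DecidableEq ι] (K : Matrix ι ι ℂ)
    (u w : ι → ℂ) (huu : star u ⬝ᵥ u = 1) (huw : star u ⬝ᵥ w = 0)
    (hK : star u ⬝ᵥ K *ᵥ u = 0)
    (hpos : 0 < (star u ⬝ᵥ (K * K) *ᵥ w + star w ⬝ᵥ (K * K) *ᵥ u).re) :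
    ∃ ρ : Matrix ι ι ℂ, ρ.PosSemidef ∧ ρ.trace = 1 ∧
      (star u ⬝ᵥ (K * K) *ᵥ u).re < dVar K ρ := by
  have hww : 0 ≤ star w ⬝ᵥ w := dotProduct_star_self_nonneg w
  obtain ⟨hk, hki⟩ := Complex.nonneg_iff.1 hww
  have hwu : star w ⬝ᵥ u = 0 := by
    have h := congrArg star huw
    rwa [star_dotProduct, star_star, star_zero] at h
  obtain ⟨t, ht⟩ := exists_lt_quotient_sub_sq hpos (star u ⬝ᵥ (K * K) *ᵥ u).re
    (star w ⬝ᵥ (K * K) *ᵥ w).re (star u ⬝ᵥ K *ᵥ w + star w ⬝ᵥ K *ᵥ u).re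
    (star w ⬝ᵥ K *ᵥ w).re (star w ⬝ᵥ w).re hk
  set v := u + (t : ℂ) • w with hv
  set N : ℝ := 1 + t ^ 2 * (star w ⬝ᵥ w).re with hN
  have hNpos : 0 < N := by positivity
  have hvv : star v ⬝ᵥ v = (N : ℂ) := by
    have hre : star w ⬝ᵥ w = ((star w ⬝ᵥ w).re : ℂ) := by
      apply Complex.ext <;> simp [← hki]
    simp only [hv, star_add, star_smul, add_dotProduct, dotProduct_add, smul_dotProduct,
      dotProduct_smul, huu, huw, hwu, smul_eq_mul, RCLike.star_def, Complex.conj_ofReal, hN]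
    rw [hre]
    push_cast
    simp only [Complex.ofReal_re]
    ring
  refine ⟨((N⁻¹ : ℝ) : ℂ) • vecMulVec v (star v), ?_, ?_, ?_⟩
  · exact (posSemidef_vecMulVec_self_star v).smul
      (Complex.zero_le_real.2 (inv_nonneg.2 hNpos.le))
  · rw [trace_smul, trace_vecMulVec, dotProduct_comm, hvv, smul_eq_mul, ← Complex.ofReal_mul,
      inv_mul_cancel₀ hNpos.ne', Complex.ofReal_one]
  · simp only [dVar, mul_smul_comm, trace_smul, trace_mul_vecMulVec, smul_eq_mul,
      Complex.re_ofReal_mul]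
    rw [hv, star_add_smul_dotProduct_mulVec, star_add_smul_dotProduct_mulVec, hK,
      Complex.zero_re, zero_add]
    exact ht

/-- For the Hermitian matrix `H = [[α, x*],[x, A]]` with `Ax ≠ αx`, there is
a density matrix `ρ` whose energy uncertainty for `H` strictly exceeds `‖x‖²`. -/
theorem stmt_7 (m : ℕ) (hm : 1 ≤ m) (α : ℝ) (x : Fin m → ℂ)
    (A : Matrix (Fin m) (Fin m) ℂ) (hA : A.IsHermitian)
    (hne : A *ᵥ x ≠ (α : ℂ) • x) :
    let H : Matrix (Fin 1 ⊕ Fin m) (Fin 1 ⊕ Fin m) ℂ :=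
      fromBlocks (of fun _ _ => (α : ℂ))
        (of fun _ j => (starRingEnd ℂ) (x j)) (of fun i _ => x i) A
    ∃ ρ : Matrix (Fin 1 ⊕ Fin m) (Fin 1 ⊕ Fin m) ℂ,
      ρ.PosSemidef ∧ ρ.trace = 1 ∧ dVar H ρ > ∑ i, ‖x i‖ ^ 2 := by
  intro H
  set B : Matrix (Fin m) (Fin m) ℂ := A - (α : ℂ) • 1 with hB
  set K : Matrix (Fin 1 ⊕ Fin m) (Fin 1 ⊕ Fin m) ℂ := fromBlocks 0
    (of fun _ j => (starRingEnd ℂ) (x j)) (of fun i _ => x i) B with hK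
  have hHK : H = K + (α : ℂ) • (1 : Matrix (Fin 1 ⊕ Fin m) (Fin 1 ⊕ Fin m) ℂ) := by
    ext (i | i) (j | j) <;> simp [H, hK, hB, one_apply, eq_iff_true_of_subsingleton]
  have hBh : B.IsHermitian := by
    refine hA.sub ?_
    simp [IsHermitian, conjTranspose_smul]
  have hKh : K.IsHermitian := by
    refine IsHermitian.fromBlocks isHermitian_zero ?_ hBh
    ext i j
    simp
  have hBx : B *ᵥ x ≠ 0 := by
    simpa [hB, sub_mulVec, smul_mulVec, sub_eq_zero] using hne
  set u : Fin 1 ⊕ Fin m → ℂ := Sum.elim 1 0 with hu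
  set w : Fin 1 ⊕ Fin m → ℂ := Sum.elim 0 (B *ᵥ x) with hw
  have hKu : K *ᵥ u = Sum.elim (0 : Fin 1 → ℂ) x := by
    ext (i | i) <;> simp [hK, hu, mulVec, dotProduct]
  have hKKu : (K * K) *ᵥ u = Sum.elim (fun _ => star x ⬝ᵥ x) (B *ᵥ x) := by
    rw [← mulVec_mulVec, hKu]
    ext (i | i) <;> simp [hK, mulVec, dotProduct]
  have hwKKu : star w ⬝ᵥ (K * K) *ᵥ u = star (B *ᵥ x) ⬝ᵥ (B *ᵥ x) := by
    rw [hKKu]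
    simp [hw, dotProduct]
  have huKKw : star u ⬝ᵥ (K * K) *ᵥ w = star (star w ⬝ᵥ (K * K) *ᵥ u) := by
    rw [← star_dotProduct_star, star_star, star_mulVec, dotProduct_mulVec,
      conjTranspose_mul, hKh.eq]
  have hpos : 0 < (star (B *ᵥ x) ⬝ᵥ (B *ᵥ x)).re :=
    (Complex.pos_iff.1 (dotProduct_star_self_pos_iff.2 hBx)).1
  obtain ⟨ρ, h1, h2, h3⟩ := exists_dVar_gt K u w (by simp [hu, dotProduct])
    (by simp [hu, hw, dotProduct]) (by rw [hKu]; simp [hu, dotProduct])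
    (by
      rw [huKKw, hwKKu, Complex.add_re, RCLike.star_def, Complex.conj_re]
      linarith)
  refine ⟨ρ, h1, h2, ?_⟩
  rw [hHK, dVar_add_smul_one K ρ α h2]
  refine lt_of_eq_of_lt ?_ h3
  rw [hKKu]
  simp [hu, dotProduct, ← Complex.normSq_eq_norm_sq, Complex.normSq_apply]
end

section
/- Let n ≥ 2 and let H be a traceless Hermitian n×n matrix in block form H = [[α, x*], [x, A]], where α ∈ ℝ, x ∈ ℂ^{n-1}, and A is an (n-1)×(n-1) Hermitian matrix with Tr(A) = -α. Suppose that the energy uncertainty of H is maximized at the first standard basis vector e₀ over all quantum states, i.e., for every density matrix ρ on ℂⁿ one has Tr(H²ρ) - (Tr(Hρ))² ≤ ΔE_{e₀}(H)². Then Ax = αx. -/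
open Matrix
open scoped ComplexOrder

theorem trace_mul_vecMulVec_star {ι : Type*} [Fintype ι] (M : Matrix ι ι ℂ) (φ : ι → ℂ) :
    (M * vecMulVec φ (star φ)).trace = star φ ⬝ᵥ M *ᵥ φ := by
  rw [mul_vecMulVec, trace_vecMulVec, dotProduct_comm]

theorem dVar_smul_vecMulVec {ι : Type*} [Fintype ι] [DecidableEq ι] (H : Matrix ι ι ℂ)
    (φ : ι → ℂ) (r : ℝ) :
    dVar H ((r : ℂ) • vecMulVec φ (star φ)) =
      r * (star φ ⬝ᵥ (H * H) *ᵥ φ).re - (r * (star φ ⬝ᵥ H *ᵥ φ).re) ^ 2 := by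
  simp only [dVar, Matrix.mul_smul, trace_smul, trace_mul_vecMulVec_star, smul_eq_mul,
    Complex.re_ofReal_mul]

/-- A bound on the energy uncertainty of all density matrices, homogenized so that it applies to
unnormalized vectors. -/
theorem homogeneous_variance_le {ι : Type*} [Fintype ι] [DecidableEq ι] {H : Matrix ι ι ℂ} {V : ℝ}
    (hV : ∀ ρ : Matrix ι ι ℂ, ρ.PosSemidef → ρ.trace = 1 → dVar H ρ ≤ V)
    {φ : ι → ℂ} {N : ℝ} (hN : 0 < N) (hφ : star φ ⬝ᵥ φ = (N : ℂ)) :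
    N * (star φ ⬝ᵥ (H * H) *ᵥ φ).re - (star φ ⬝ᵥ H *ᵥ φ).re ^ 2 ≤ V * N ^ 2 := by
  have h := hV (((N⁻¹ : ℝ) : ℂ) • vecMulVec φ (star φ))
    ((posSemidef_vecMulVec_self_star φ).smul (by exact_mod_cast (inv_pos.mpr hN).le))
    (by
      have : (N : ℂ) ≠ 0 := by exact_mod_cast hN.ne'
      rw [trace_smul, trace_vecMulVec, dotProduct_comm, hφ]
      simp [this])
  rw [dVar_smul_vecMulVec] at h
  have h' := mul_le_mul_of_nonneg_right h (sq_nonneg N)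
  field_simp at h'
  linarith

theorem Matrix.IsHermitian.dotProduct_mul_self_mulVec {ι : Type*} [Fintype ι] {H : Matrix ι ι ℂ}
    (hH : H.IsHermitian) (φ : ι → ℂ) :
    star φ ⬝ᵥ (H * H) *ᵥ φ = star (H *ᵥ φ) ⬝ᵥ H *ᵥ φ := by
  rw [← mulVec_mulVec, dotProduct_mulVec, star_mulVec, hH.eq]

/-- If the quartic obtained by expanding the homogenized variance bound along a line holds for all
real `s`, its linear coefficient `2 * Y` vanishes. -/
theorem eq_zero_of_forall_quartic_le {α X Y P Q C : ℝ}
    (h : ∀ s : ℝ, (1 + s ^ 2 * Y) * (α ^ 2 + X + s * (4 * α * P + 2 * Y) + s ^ 2 * C) -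
      (α + 2 * s * P + s ^ 2 * Q) ^ 2 ≤ X * (1 + s ^ 2 * Y) ^ 2) : Y = 0 := by
  let f : ℝ → ℝ := fun s =>
    (1 + s ^ 2 * Y) * (α ^ 2 + X + s * (4 * α * P + 2 * Y) + s ^ 2 * C) -
      (α + 2 * s * P + s ^ 2 * Q) ^ 2 - X * (1 + s ^ 2 * Y) ^ 2
  have hmax : IsLocalMax f 0 := Filter.Eventually.of_forall fun s => by
    have := h s
    simp only [f]
    linarith
  have hid : HasDerivAt (fun s : ℝ => s) 1 0 := hasDerivAt_id 0
  have hN := ((hid.pow 2).mul_const Y).const_add 1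
  have hS := ((hid.mul_const (4 * α * P + 2 * Y)).const_add (α ^ 2 + X)).add
    ((hid.pow 2).mul_const C)
  have hE := (((hid.const_mul 2).mul_const P).const_add α).add ((hid.pow 2).mul_const Q)
  have hf : HasDerivAt f _ 0 := ((hN.mul hS).sub (hE.pow 2)).sub ((hN.pow 2).const_mul X)
  have h0 := hmax.hasDerivAt_eq_zero hf
  simp at h0
  linarith

/-- If the energy uncertainty of the traceless Hermitian matrix
`H = [[α, x*],[x, A]]` (with `Tr(A) = -α`) is maximized over all density matrices at the
first standard basis vector `e₀`, then `Ax = αx`. -/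
theorem stmt_9 (m : ℕ) (hm : 1 ≤ m) (α : ℝ) (x : Fin m → ℂ)
    (A : Matrix (Fin m) (Fin m) ℂ) (hA : A.IsHermitian)
    (htr : A.trace = -(α : ℂ)) :
    let H : Matrix (Fin 1 ⊕ Fin m) (Fin 1 ⊕ Fin m) ℂ :=
      fromBlocks (of fun _ _ => (α : ℂ))
        (of fun _ j => (starRingEnd ℂ) (x j)) (of fun i _ => x i) A
    let e₀ : Fin 1 ⊕ Fin m → ℂ := Sum.elim (fun _ => 1) (fun _ => 0)
    (∀ ρ : Matrix (Fin 1 ⊕ Fin m) (Fin 1 ⊕ Fin m) ℂ,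
      ρ.PosSemidef → ρ.trace = 1 → dVar H ρ ≤ eVar H e₀) →
    A *ᵥ x = (α : ℂ) • x := by
  intro H e₀ hmax
  have hH : H.IsHermitian := by
    refine IsHermitian.fromBlocks ?_ ?_ hA
    · ext i j; simp
    · ext i j; simp
  set y : Fin m → ℂ := A *ᵥ x - (α : ℂ) • x with hy
  have hHφ (v : Fin m → ℂ) : H *ᵥ Sum.elim (fun _ => 1) v =
      Sum.elim (fun _ => (α : ℂ) + star x ⬝ᵥ v) (x + A *ᵥ v) := by
    rw [fromBlocks_mulVec]
    congr 1 <;> ext i <;> simp [mulVec, dotProduct]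
  have hdot (a b : ℂ) (u v : Fin m → ℂ) :
      star (Sum.elim (fun _ : Fin 1 => a) u) ⬝ᵥ Sum.elim (fun _ : Fin 1 => b) v =
        star a * b + star u ⬝ᵥ v := by
    simp [dotProduct]
  have hre (u v : Fin m → ℂ) : (star u ⬝ᵥ v).re = (star v ⬝ᵥ u).re := by
    rw [star_dotProduct, Complex.star_def, Complex.conj_re]
  have hself (u : Fin m → ℂ) : ((star u ⬝ᵥ u).re : ℂ) = star u ⬝ᵥ u :=
    (Complex.eq_re_of_ofReal_le (r := 0) (by simp)).symm
  have hY : 0 ≤ (star y ⬝ᵥ y).re :=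
    (Complex.le_def.mp (dotProduct_star_self_nonneg y)).1
  have hxAy : (star x ⬝ᵥ A *ᵥ y).re = (star y ⬝ᵥ y).re + α * (star x ⬝ᵥ y).re := by
    have hAx : A *ᵥ x = y + (α : ℂ) • x := by simp [hy]
    have : star x ⬝ᵥ A *ᵥ y = star (A *ᵥ x) ⬝ᵥ y := by
      rw [dotProduct_mulVec, star_mulVec, hA.eq]
    rw [this, hAx]
    simp [add_dotProduct]
  have hV : eVar H e₀ = (star x ⬝ᵥ x).re := by
    have he : e₀ = Sum.elim (fun _ => 1) 0 := rfl
    rw [eVar, hH.dotProduct_mul_self_mulVec, he, hHφ, hdot, hdot]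
    simp
    ring
  rw [hV] at hmax
  suffices (star y ⬝ᵥ y).re = 0 by
    have h0 : star y ⬝ᵥ y = 0 := by rw [← hself, this, Complex.ofReal_zero]
    exact sub_eq_zero.mp (dotProduct_star_self_eq_zero.mp h0)
  refine eq_zero_of_forall_quartic_le (α := α) (X := (star x ⬝ᵥ x).re) (P := (star x ⬝ᵥ y).re)
    (Q := (star y ⬝ᵥ A *ᵥ y).re)
    (C := Complex.normSq (star x ⬝ᵥ y) + (star (A *ᵥ y) ⬝ᵥ A *ᵥ y).re) fun s => ?_
  have hφ := homogeneous_variance_le hmax (φ := Sum.elim (fun _ => 1) ((s : ℂ) • y))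
    (N := 1 + s ^ 2 * (star y ⬝ᵥ y).re) (by positivity) (by
      rw [hdot]
      push_cast
      rw [hself]
      simp
      ring)
  rw [hH.dotProduct_mul_self_mulVec, hHφ, hdot, hdot] at hφ
  convert hφ using 3
  · have h1 := hre (A *ᵥ y) x
    rw [hxAy] at h1
    simp [mulVec_smul, add_dotProduct, dotProduct_add, h1, hxAy, Complex.normSq_apply]
    ring
  · have h1 := hre y x
    simp [mulVec_smul, dotProduct_add, h1]
    ring
end
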